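/- ∫₀^∞ sin(π x/2)/(exp(2π√x) − 1) dx = (π − 3)/(4π). -/

import Mathlib

open Real MeasureTheory

open Complex Filter Topology in
lemma rect_lim (f : ℂ → ℂ) (hc : ContinuousOn f {z : ℂ | 0 ≤ z.re ∧ 0 ≤ z.im ∧ z.im ≤ 2})
    (hd : ∀ z : ℂ, 0 < z.re → 0 < z.im → z.im < 2 → DifferentiableAt ℂ f z)
    (B : ℝ → ℝ) (hB : Tendsto B atTop (𝓝 0))
    (hb : ∀ R : ℝ, 1 ≤ R → ∀ y : ℝ, 0 ≤ y → y ≤ 2 → ‖f (R + y * I)‖ ≤ B R) :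
    Tendsto (fun R : ℝ => ∫ x in (0:ℝ)..R, (f x - f (x + 2 * I))) atTop
      (𝓝 (I * ∫ y in (0:ℝ)..2, f (y * I))) := by
  have h1 : ∀ R : ℝ, 1 ≤ R → I * (∫ y in (0:ℝ)..2, f (y * I)) - I * (∫ y in (0:ℝ)..2, f (R + y * I))
      = ∫ x in (0:ℝ)..R, (f x - f (x + 2 * I)) := by
    intro R hR
    have h := Complex.integral_boundary_rect_eq_zero_of_continuousOn_of_differentiableOn f 0 (R + 2 * I)
      (hc.mono ?_) ?_
    · simp at h
      rw [intervalIntegral.integral_sub]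
      · linear_combination -h
      · apply ContinuousOn.intervalIntegrable
        apply hc.comp (by fun_prop)
        intro x hx
        rw [Set.uIcc_of_le (by linarith)] at hx
        simp; exact hx.1
      · apply ContinuousOn.intervalIntegrable
        apply hc.comp (by fun_prop)
        intro x hx
        rw [Set.uIcc_of_le (by linarith)] at hx
        simp; exact hx.1
    · intro z hz
      rw [Complex.mem_reProdIm] at hz
      simp at hz
      rw [Set.uIcc_of_le (by linarith)] at hz
      exact ⟨hz.1.1, hz.2.1, hz.2.2⟩
    · intro z hz
      rw [Complex.mem_reProdIm] at hz
      simp at hz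
      refine (hd z ?_ ?_ ?_).differentiableWithinAt
      · rcases hz.1.1 with h | h <;> linarith
      · linarith
      · linarith
  have h2 : Tendsto (fun R : ℝ => I * (∫ y in (0:ℝ)..2, f (R + y * I))) atTop (𝓝 0) := by
    have h3 : Tendsto (fun R => B R * 2) atTop (𝓝 0) := by simpa using hB.mul_const 2
    refine squeeze_zero_norm' ?_ h3
    filter_upwards [eventually_ge_atTop 1] with R hR
    have := intervalIntegral.norm_integral_le_of_norm_le_const (a := 0) (b := 2)
      (f := fun y : ℝ => f (R + y * I)) (C := B R) ?_
    · simpa using this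
    · intro y hy
      rw [Set.uIoc_of_le (by norm_num)] at hy
      exact hb R hR y hy.1.le hy.2
  have h4 := (tendsto_const_nhds (x := I * ∫ y in (0:ℝ)..2, f (y * I))).sub h2
  rw [sub_zero] at h4
  refine h4.congr' ?_
  filter_upwards [eventually_ge_atTop 1] with R hR
  exact h1 R hR

noncomputable def ee (z : ℂ) : ℂ := Complex.exp (Complex.I * π * z ^ 2 / 2)

open Complex in
lemma ee_norm (x y : ℝ) : ‖ee (x + y * I)‖ = Real.exp (-(π * x * y)) := by
  rw [ee, Complex.norm_exp]
  congr 1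
  simp [pow_two]
  ring

open Complex in
lemma ee_cont : Continuous ee := by unfold ee; fun_prop

open Complex in
lemma ee_shift (z : ℂ) : ee (z + 2 * I) = ee z * cexp (-(2 * π * z)) := by
  rw [ee, ee, ← Complex.exp_add, Complex.exp_eq_exp_iff_exists_int]
  refine ⟨-1, ?_⟩
  push_cast
  ring_nf
  simp [show Complex.I^3 = -Complex.I by rw [pow_succ, Complex.I_sq]; ring]
  ring

open Complex in
lemma gauss_delta (δ : ℝ) (hδ : 0 < δ) :
    (∫ x in Set.Ioi (0:ℝ), ee (x + 2 * I) * cexp (-δ * (x + 2 * I) ^ 2))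
      + I * ∫ y in (0:ℝ)..2, ee (y * I) * cexp (-δ * (y * I) ^ 2)
      = (π / (δ - π / 2 * I)) ^ (1 / 2 : ℂ) / 2 := by
  set b : ℂ := δ - π / 2 * I with hb
  have hbre : 0 < b.re := by simp [hb, hδ]
  have hfe : ∀ z : ℂ, ee z * cexp (-δ * z ^ 2) = cexp (-b * z ^ 2) := by
    intro z
    rw [ee, ← Complex.exp_add]
    congr 1
    rw [hb]; ring
  have hn : ∀ x y : ℝ, ‖ee (x + y * I) * cexp (-δ * (x + y * I) ^ 2)‖
      = Real.exp (-(π * x * y) - δ * (x ^ 2 - y ^ 2)) := by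
    intro x y
    rw [norm_mul, ee_norm, Complex.norm_exp, ← Real.exp_add]
    congr 1
    simp [pow_two]
    ring
  have hsq : Integrable (fun x : ℝ => Real.exp (-δ * x ^ 2)) := integrable_exp_neg_mul_sq hδ
  have hlim := rect_lim (fun z => ee z * cexp (-δ * z ^ 2))
    (by unfold ee; fun_prop) (by intro z _ _ _; unfold ee; fun_prop)
    (fun R => Real.exp (4 * δ) * Real.exp (- δ * R)) ?_ ?_
  · have hi1 : IntegrableOn (fun x : ℝ => ee x * cexp (-δ * (x : ℂ) ^ 2)) (Set.Ioi 0) := by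
      simp only [hfe]
      exact (integrable_cexp_neg_mul_sq hbre).integrableOn
    have hi2 : IntegrableOn (fun x : ℝ => ee (x + 2 * I) * cexp (-δ * ((x : ℂ) + 2 * I) ^ 2)) (Set.Ioi 0) := by
      refine Integrable.mono' (g := fun x => Real.exp (4 * δ) * Real.exp (-δ * x ^ 2)) (hsq.const_mul _).integrableOn
        (Continuous.aestronglyMeasurable (by unfold ee; fun_prop)) ?_
      filter_upwards [ae_restrict_mem measurableSet_Ioi] with x hx
      have := hn x 2
      push_cast at this
      rw [this, ← Real.exp_add]
      apply Real.exp_le_exp.2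
      have hx : 0 < x := hx
      have : 0 < π * x := by positivity
      nlinarith
    have h1 := intervalIntegral_tendsto_integral_Ioi 0 (hi1.sub hi2) Filter.tendsto_id
    have h2 := tendsto_nhds_unique hlim h1
    simp only [Pi.sub_apply] at h2
    rw [integral_sub hi1 hi2] at h2
    have h3 := integral_gaussian_complex_Ioi hbre
    simp only [← hfe] at h3
    rw [h3] at h2
    rw [h2]; ring
  · have : Filter.Tendsto (fun R : ℝ => - δ * R) Filter.atTop Filter.atBot :=
      Filter.tendsto_id.const_mul_atTop_of_neg (by linarith)
    simpa using (Real.tendsto_exp_atBot.comp this).const_mul (Real.exp (4 * δ))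
  · intro R hR y hy hy2
    rw [hn, ← Real.exp_add]
    apply Real.exp_le_exp.2
    have : 0 ≤ π * R * y := by positivity
    have h3 : δ * y ^ 2 ≤ δ * 4 := by gcongr; nlinarith
    have h4 : δ * R ≤ δ * R ^ 2 := by gcongr; nlinarith
    nlinarith

lemma ee_int : IntegrableOn (fun x : ℝ => ee (x + 2 * Complex.I)) (Set.Ioi 0) := by
  refine Integrable.mono' (g := fun x => Real.exp (-(2 * π) * x)) (integrableOn_exp_mul_Ioi (by linarith [pi_pos]) 0)
    (Continuous.aestronglyMeasurable (by unfold ee; fun_prop)) ?_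
  filter_upwards with x
  have := ee_norm x 2
  push_cast at this
  rw [this]
  apply le_of_eq; ring_nf

open Complex Filter Topology in
lemma fresnel :
    (∫ x in Set.Ioi (0:ℝ), ee (x + 2 * I)) + I * ∫ y in (0:ℝ)..2, ee (y * I) = (1 + I) / 2 := by
  have h1 : Tendsto (fun δ : ℝ => (∫ x in Set.Ioi (0:ℝ), ee (x + 2 * I) * cexp (-δ * (x + 2 * I) ^ 2))
      + I * ∫ y in (0:ℝ)..2, ee (y * I) * cexp (-δ * (y * I) ^ 2)) (𝓝[>] 0)
      (𝓝 ((∫ x in Set.Ioi (0:ℝ), ee (x + 2 * I) * cexp (-(0:ℝ) * (x + 2 * I) ^ 2))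
      + I * ∫ y in (0:ℝ)..2, ee (y * I) * cexp (-(0:ℝ) * (y * I) ^ 2))) := by
    refine Tendsto.add ?_ (Tendsto.const_mul _ ?_)
    · refine tendsto_integral_filter_of_dominated_convergence
        (fun x => Real.exp 4 * ‖ee (x + 2 * I)‖) ?_ ?_ (ee_int.norm.const_mul _) ?_
      · filter_upwards with δ
        exact (Continuous.aestronglyMeasurable (by unfold ee; fun_prop))
      · filter_upwards [Ioo_mem_nhdsGT (show (0:ℝ) < 1 by norm_num)] with δ hδ
        filter_upwards with x
        rw [norm_mul, mul_comm]
        gcongr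
        rw [Complex.norm_exp]
        apply Real.exp_le_exp.2
        simp [pow_two]
        nlinarith [hδ.1, hδ.2, mul_nonneg hδ.1.le (mul_self_nonneg x)]
      · filter_upwards with x
        refine Tendsto.mono_left (Continuous.tendsto ?_ 0) nhdsWithin_le_nhds
        fun_prop
    · refine Tendsto.mono_left (Continuous.tendsto ?_ 0) nhdsWithin_le_nhds
      apply intervalIntegral.continuous_parametric_intervalIntegral_of_continuous'
      unfold ee Function.uncurry
      fun_prop
  have h2 : Tendsto (fun δ : ℝ => ((π:ℂ) / (δ - π / 2 * I)) ^ (1 / 2 : ℂ) / 2) (𝓝[>] 0)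
      (𝓝 (((π:ℂ) / ((0:ℝ) - π / 2 * I)) ^ (1 / 2 : ℂ) / 2)) := by
    refine Tendsto.mono_left (ContinuousAt.tendsto ?_) nhdsWithin_le_nhds
    have hne : (((0:ℝ):ℂ) - π / 2 * I : ℂ) ≠ 0 := by simp [pi_ne_zero]
    have hc1 : ContinuousAt (fun δ : ℝ => (π:ℂ) / (δ - π / 2 * I)) 0 :=
      ContinuousAt.div continuousAt_const (by fun_prop) hne
    have hs : (π:ℂ) / (((0:ℝ):ℂ) - π / 2 * I) ∈ slitPlane := by
      right
      simp [Complex.div_im, normSq, pi_ne_zero]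
    exact (hc1.cpow continuousAt_const hs).div_const 2
  have h3 := tendsto_nhds_unique h1 (h2.congr' (by
    filter_upwards [self_mem_nhdsWithin] with δ hδ
    exact (gauss_delta δ hδ).symm))
  simp at h3
  rw [h3]
  have h4 : (π:ℂ) / (-(π / 2 * I)) = (1 + I) ^ 2 := by
    have : (π:ℂ) ≠ 0 := by exact_mod_cast pi_ne_zero
    field_simp
    ring_nf
    simp [show Complex.I^3 = -Complex.I by rw [pow_succ, Complex.I_sq]; ring]
  rw [h4]
  congr 1
  simpa using Complex.sq_cpow_two_inv (x := 1 + I) (by simp)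

noncomputable def ww (z : ℂ) : ℂ := z * (z - 2 * Complex.I) * ee z

open Complex in
lemma ee_deriv (z : ℂ) : HasDerivAt ee (I * π * z * ee z) z := by
  have h : HasDerivAt (fun z : ℂ => I * π * z ^ 2 / 2) (I * π * z) z := by
    have := (((hasDerivAt_id z).pow 2).const_mul (I * π)).div_const 2
    convert! this using 1
    simp; ring
  have := h.cexp
  unfold ee
  convert! this using 1
  ring

open Complex in
lemma vv_deriv (z : ℂ) : HasDerivAt (fun z => (z - 2 * I) * ee z / (I * π)) (ee z / (I * π) + ww z) z := by
  have := ((((hasDerivAt_id z).sub_const (2 * I)).mul (ee_deriv z)).div_const (I * π))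
  convert! this using 1
  have : (π:ℂ) ≠ 0 := by exact_mod_cast pi_ne_zero
  have := I_ne_zero
  simp only [ww, id]
  field_simp

open Complex in
lemma ww_norm (x : ℝ) (hx : 0 < x) : ‖ww (x + 2 * I)‖ ≤ x * (x + 2) * Real.exp (-(2 * π) * x) := by
  have := ee_norm x 2
  push_cast at this
  rw [ww, norm_mul, this, norm_mul]
  have h1 : ‖(x:ℂ) + 2 * I‖ ≤ x + 2 := by
    refine (norm_add_le _ _).trans ?_
    simp [abs_of_pos hx]
  have h2 : ‖(x:ℂ) + 2 * I - 2 * I‖ = x := by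
    simp [abs_of_pos hx]
  rw [h2, mul_comm (‖_‖) x, show -(π * x * 2) = -(2 * π) * x by ring]
  gcongr

lemma poly_exp (x : ℝ) (hx : 0 < x) : x * (x + 2) * Real.exp (-(2 * π) * x) ≤ 3 * Real.exp (-x) := by
  have h1 : x * (x + 2) ≤ 3 * Real.exp (2 * x) := by
    have := Real.quadratic_le_exp_of_nonneg (x := 2 * x) (by linarith)
    nlinarith
  calc _ ≤ (3 * Real.exp (2 * x)) * Real.exp (-(2 * π) * x) := by gcongr
    _ = 3 * Real.exp (2 * x + -(2 * π) * x) := by rw [Real.exp_add]; ring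
    _ ≤ _ := by
      gcongr
      nlinarith [pi_gt_three]

lemma ww_int : IntegrableOn (fun x : ℝ => ww (x + 2 * Complex.I)) (Set.Ioi 0) := by
  refine Integrable.mono' (g := fun x => 3 * Real.exp (-x)) ((integrableOn_exp_neg_Ioi 0).const_mul 3)
    (Continuous.aestronglyMeasurable (by unfold ww ee; fun_prop)) ?_
  filter_upwards [ae_restrict_mem measurableSet_Ioi] with x hx
  exact (ww_norm x hx).trans (poly_exp x hx)

open Complex Filter Topology in
lemma ww_eval :
    (∫ x in Set.Ioi (0:ℝ), ww (x + 2 * I)) + I * ∫ y in (0:ℝ)..2, ww (y * I)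
      = 2 / π - (1 + I) / 2 / (I * π) := by
  have hpi : (π:ℂ) ≠ 0 := by exact_mod_cast pi_ne_zero
  have hwc : Continuous ww := by unfold ww ee; fun_prop
  have h1 : (∫ x in Set.Ioi (0:ℝ), (ee (x + 2 * I) / (I * π) + ww (x + 2 * I))) = 0 := by
    have := integral_Ioi_of_hasDerivAt_of_tendsto' (a := 0) (m := (0:ℂ))
      (f := fun x : ℝ => ((x:ℂ) + 2 * I - 2 * I) * ee (x + 2 * I) / (I * π))
      (f' := fun x : ℝ => (ee (x + 2 * I) / (I * π) + ww (x + 2 * I))) ?_ ?_ ?_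
    · rw [this]; simp
    · intro x _
      exact ((vv_deriv (x + 2 * I)).comp_add_const (x:ℂ) (2 * I)).comp_ofReal
    · exact (ee_int.div_const _).add ww_int
    · have h0 : Tendsto (fun x : ℝ => 3 * Real.exp (-x)) atTop (𝓝 0) := by
        simpa using Real.tendsto_exp_neg_atTop_nhds_zero.const_mul 3
      refine squeeze_zero_norm' ?_ h0
      filter_upwards [eventually_gt_atTop 0] with x hx
      refine le_trans ?_ (poly_exp x hx)
      have := ee_norm x 2
      push_cast at this
      rw [norm_div, norm_mul, this, show -(π * x * 2) = -(2 * π) * x by ring]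
      simp only [add_sub_cancel_right, norm_mul, norm_real, norm_I, one_mul]
      rw [Real.norm_of_nonneg hx.le, Real.norm_of_nonneg pi_pos.le]
      refine (div_le_self (by positivity) (by linarith [pi_gt_three])).trans ?_
      gcongr
      nlinarith
  have h2 : (∫ y in (0:ℝ)..2, (ee (y * I) / (I * π) + ww (y * I)) * I) = 2 / π := by
    rw [intervalIntegral.integral_eq_sub_of_hasDerivAt
      (f := fun y : ℝ => ((y:ℂ) * I - 2 * I) * ee (y * I) / (I * π))]
    · simp [ee]
      field_simp
    · intro x _
      have h := (HasDerivAt.comp (x:ℂ) (vv_deriv (x * I)) ((hasDerivAt_id (x:ℂ)).mul_const I)).comp_ofReal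
      simpa [Function.comp_def] using h
    · apply Continuous.intervalIntegrable
      have := ee_cont
      fun_prop
  rw [integral_add (ee_int.div_const _) ww_int, integral_div] at h1
  rw [intervalIntegral.integral_mul_const, intervalIntegral.integral_add, intervalIntegral.integral_div] at h2
  · rw [← fresnel, ← h2]
    have := I_ne_zero
    field_simp
    field_simp at h1
    linear_combination h1
  · apply Continuous.intervalIntegrable
    have := ee_cont
    fun_prop
  · apply Continuous.intervalIntegrable
    fun_prop

noncomputable def bb (w : ℂ) : ℂ := (dslope (fun w : ℂ => Complex.exp (2 * π * w)) 0 w)⁻¹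

open Complex in
lemma bb_ne (w : ℂ) (hw : w ≠ 0) : bb w = w / (cexp (2 * π * w) - 1) := by
  rw [bb, dslope_of_ne _ hw, slope_def_field]
  simp

open Complex in
lemma bb_aux : dslope (fun w : ℂ => cexp (2 * π * w)) 0 0 = 2 * π := by
  rw [dslope_same]
  have : HasDerivAt (fun w : ℂ => cexp (2 * π * w)) (cexp (2 * π * 0) * (2 * π * 1)) 0 :=
    ((hasDerivAt_id (0:ℂ)).const_mul (2 * π : ℂ)).cexp
  rw [this.deriv]; simp

open Complex in
lemma bb_zero : bb 0 = 1 / (2 * π) := by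
  rw [bb, bb_aux, one_div]

open Complex in
lemma bb_diff : DifferentiableAt ℂ bb 0 := by
  unfold bb
  apply DifferentiableAt.inv
  · have := (Complex.differentiableOn_dslope (f := fun w : ℂ => cexp (2 * π * w)) (s := Set.univ) (c := 0)
      Filter.univ_mem).2 (by fun_prop)
    exact this.differentiableAt Filter.univ_mem
  · rw [bb_aux]; simp [pi_ne_zero]

noncomputable def GG (z : ℂ) : ℂ := ww z / (Complex.exp (2 * π * z) - 1)
noncomputable def rr : ℂ := -Complex.I / (2 * π)
noncomputable def kk (z : ℂ) : ℂ := z * (z - 2 * Complex.I) * ee z * bb (z - Complex.I)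

open Classical in
noncomputable def HH (z : ℂ) : ℂ :=
  if z = 0 then (z - 2 * Complex.I) * ee z * bb z - rr / (z - Complex.I)
  else if z = Complex.I then deriv kk Complex.I
  else if z = 2 * Complex.I then z * ee z * bb (z - 2 * Complex.I) - rr / (z - Complex.I)
  else GG z - rr / (z - Complex.I)

open Complex in
lemma HH_ne (z : ℂ) (h0 : z ≠ 0) (h1 : z ≠ I) (h2 : z ≠ 2 * I) : HH z = GG z - rr / (z - I) := by
  simp [HH, h0, h1, h2]

open Complex in
lemma ee_I : ee I = -I := by
  rw [ee, show I * π * I ^ 2 / 2 = -(π / 2 * I) by rw [I_sq]; ring, Complex.exp_neg, Complex.exp_pi_div_two_mul_I]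
  simp

open Complex in
lemma kk_I : kk I = rr := by
  rw [kk, sub_self, bb_zero, ee_I, rr]
  ring_nf
  simp [show Complex.I^3 = -Complex.I by rw [pow_succ, Complex.I_sq]; ring]
  ring

open Complex in
lemma kk_diff : DifferentiableAt ℂ kk I := by
  unfold kk
  have h1 : DifferentiableAt ℂ (fun z => bb (z - I)) I := by
    have h := bb_diff
    rw [← sub_self I] at h
    exact DifferentiableAt.comp (g := bb) (f := fun z => z - I) I h (by fun_prop)
  have h2 := (ee_deriv I).differentiableAt
  fun_prop

open Complex in
lemma HH_cont0 : ContinuousAt HH 0 := by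
  have h : ContinuousAt (fun z => (z - 2 * I) * ee z * bb z - rr / (z - I)) 0 := by
    have h1 := bb_diff.continuousAt
    have h2 := ee_cont
    refine ContinuousAt.sub (by fun_prop) (ContinuousAt.div (by fun_prop) (by fun_prop) (by simp))
  refine h.congr ?_
  filter_upwards [isOpen_ne.mem_nhds (show (0:ℂ) ≠ I by simp [eq_comm]),
    isOpen_ne.mem_nhds (show (0:ℂ) ≠ 2 * I by simp)] with z hz1 hz2
  by_cases hz : z = 0
  · simp [HH, hz]
  · rw [HH_ne z hz hz1 hz2, bb_ne z hz, GG, ww]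
    ring

open Complex in
lemma HH_cont2 : ContinuousAt HH (2 * I) := by
  have h : ContinuousAt (fun z => z * ee z * bb (z - 2 * I) - rr / (z - I)) (2 * I) := by
    have h1 : ContinuousAt (fun z => bb (z - 2 * I)) (2 * I) := by
      have h := bb_diff.continuousAt
      rw [← sub_self (2 * I)] at h
      exact ContinuousAt.comp (f := fun z => z - 2 * I) h (by fun_prop)
    have h2 := ee_cont
    refine ContinuousAt.sub (by fun_prop) (ContinuousAt.div (by fun_prop) (by fun_prop) ?_)
    rw [show 2 * I - I = I by ring]; simp
  refine h.congr ?_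
  have hI : 2 * I ≠ I := by
    intro h
    have : I = 0 := by linear_combination h
    exact I_ne_zero this
  filter_upwards [isOpen_ne.mem_nhds hI,
    isOpen_ne.mem_nhds (show 2 * I ≠ 0 by simp)] with z hz1 hz2
  by_cases hz : z = 2 * I
  · subst hz
    simp [HH, hI]
  · rw [HH_ne z hz2 hz1 hz, bb_ne _ (sub_ne_zero.2 hz), GG, ww,
      show 2 * π * (z - 2 * I) = 2 * π * z - 2 * π * I - 2 * π * I by ring, Complex.exp_periodic.sub_eq,
      Complex.exp_periodic.sub_eq]
    ring

open Complex in
lemma HH_cont1 : ContinuousAt HH I := by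
  have h := continuousAt_dslope_same.2 kk_diff
  refine h.congr ?_
  have hI : I ≠ 2 * I := by
    intro h
    have : I = 0 := by linear_combination -h
    exact I_ne_zero this
  filter_upwards [isOpen_ne.mem_nhds hI,
    isOpen_ne.mem_nhds I_ne_zero] with z hz2 hz1
  by_cases hz : z = I
  · subst hz
    simp [HH]
  · rw [HH_ne z hz1 hz hz2, dslope_of_ne _ hz, slope_def_field, kk_I, kk, bb_ne _ (sub_ne_zero.2 hz), GG, ww,
      show 2 * π * (z - I) = 2 * π * z - 2 * π * I by ring, Complex.exp_periodic.sub_eq]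
    have := sub_ne_zero.2 hz
    field_simp

open Complex in
lemma exp_ne_one (z : ℂ) (hi0 : 0 ≤ z.im) (hi2 : z.im ≤ 2) (h0 : z ≠ 0) (h1 : z ≠ I) (h2 : z ≠ 2 * I) :
    cexp (2 * π * z) - 1 ≠ 0 := by
  intro h
  rw [sub_eq_zero, Complex.exp_eq_one_iff] at h
  obtain ⟨n, hn⟩ := h
  have hz : z = n * I := by
    have : (2 * π : ℂ) ≠ 0 := by simp [pi_ne_zero]
    apply mul_left_cancel₀ this
    rw [hn]; ring
  have hn' : z.im = n := by rw [hz]; simp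
  rw [hn'] at hi0 hi2
  have a0 : 0 ≤ n := by exact_mod_cast hi0
  have a2 : n ≤ 2 := by exact_mod_cast hi2
  interval_cases n <;> simp_all

open Complex in
lemma HH_diff (z : ℂ) (hi0 : 0 ≤ z.im) (hi2 : z.im ≤ 2) (h0 : z ≠ 0) (h1 : z ≠ I) (h2 : z ≠ 2 * I) :
    DifferentiableAt ℂ HH z := by
  have h : DifferentiableAt ℂ (fun z => GG z - rr / (z - I)) z := by
    unfold GG ww
    have h3 := (ee_deriv z).differentiableAt
    refine DifferentiableAt.sub (DifferentiableAt.div (by fun_prop) (by fun_prop) (exp_ne_one z hi0 hi2 h0 h1 h2))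
      (DifferentiableAt.div (by fun_prop) (by fun_prop) (sub_ne_zero.2 h1))
  refine h.congr_of_eventuallyEq ?_
  filter_upwards [isOpen_ne.mem_nhds h0, isOpen_ne.mem_nhds h1, isOpen_ne.mem_nhds h2] with w w0 w1 w2
  exact HH_ne w w0 w1 w2

open Complex in
lemma HH_cont (z : ℂ) (hi0 : 0 ≤ z.im) (hi2 : z.im ≤ 2) : ContinuousAt HH z := by
  by_cases h0 : z = 0
  · rw [h0]; exact HH_cont0
  by_cases h1 : z = I
  · rw [h1]; exact HH_cont1
  by_cases h2 : z = 2 * I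
  · rw [h2]; exact HH_cont2
  exact (HH_diff z hi0 hi2 h0 h1 h2).continuousAt

open Complex in
lemma HH_bound (R : ℝ) (hR : 1 ≤ R) (y : ℝ) (hy : 0 ≤ y) (hy2 : y ≤ 2) : ‖HH (R + y * I)‖ ≤ 10 / R := by
  have hre : ((R:ℂ) + y * I).re = R := by simp
  rw [HH_ne]
  · have h1 : ‖GG (R + y * I)‖ ≤ 9 / R := by
      rw [GG, ww, norm_div, norm_mul, norm_mul, ee_norm]
      have a1 : ‖(R:ℂ) + y * I‖ ≤ 3 * R := by
        refine (norm_add_le _ _).trans ?_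
        simp [abs_of_nonneg hy, abs_of_pos (show 0 < R by linarith)]
        linarith
      have a2 : ‖(R:ℂ) + y * I - 2 * I‖ ≤ 3 * R := by
        rw [show (R:ℂ) + y * I - 2 * I = R + ((y - 2 : ℝ):ℂ) * I by push_cast; ring]
        refine (norm_add_le _ _).trans ?_
        simp [abs_of_pos (show 0 < R by linarith)]
        rw [← ofReal_ofNat, ← ofReal_sub, norm_real, Real.norm_eq_abs, abs_of_nonpos (by linarith)]
        linarith
      have a3 : Real.exp (-(π * R * y)) ≤ 1 := by
        rw [Real.exp_le_one_iff]
        have : 0 ≤ π * R * y := by positivity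
        linarith
      have a4 : R ^ 3 ≤ ‖cexp (2 * π * (R + y * I)) - 1‖ := by
        have b1 := norm_sub_norm_le (cexp (2 * π * (R + y * I))) 1
        rw [Complex.norm_exp] at b1
        have b2 := Real.pow_div_factorial_le_exp (x := (2 * π * (R + y * I) : ℂ).re) (by simp; positivity) 3
        simp [Nat.factorial] at b1 b2
        have b3 : (2 * 3 * R) ^ 3 ≤ (2 * π * R) ^ 3 := by
          gcongr
          exact pi_gt_three.le
        have b4 : 1 ≤ R ^ 3 := one_le_pow₀ hR
        nlinarith
      calc _ ≤ (3 * R) * (3 * R) * 1 / R ^ 3 := by gcongr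
        _ = 9 / R := by field_simp; norm_num
    have h2 : ‖rr / (R + y * I - I)‖ ≤ 1 / R := by
      rw [norm_div]
      have a1 : R ≤ ‖(R:ℂ) + y * I - I‖ := by
        have := Complex.re_le_norm ((R:ℂ) + y * I - I)
        simpa using this
      have a2 : ‖rr‖ ≤ 1 := by
        rw [rr, norm_div]
        simp [abs_of_pos pi_pos]
        have := pi_gt_three
        have : π⁻¹ ≤ 1 := inv_le_one_of_one_le₀ (by linarith)
        nlinarith [inv_pos.2 pi_pos]
      gcongr
    calc _ ≤ _ := norm_sub_le _ _
      _ ≤ 9 / R + 1 / R := by gcongr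
      _ = 10 / R := by ring
  all_goals
    intro h
    rw [h] at hre
    simp at hre
    linarith

open Complex in
lemma ww_refl (z : ℂ) : ww (2 * I - z) = ww z * cexp (2 * π * z) := by
  have h := ee_shift (-z)
  rw [ww, ww, show 2 * I - z = -z + 2 * I by ring, h]
  have h2 : ee (-z) = ee z := by simp [ee]
  rw [h2]
  ring_nf

open Complex in
lemma HH_refl (y : ℝ) (hy : 0 < y) (hy2 : y < 2) (hy1 : y ≠ 1) :
    HH (y * I) + HH ((2 - y : ℝ) * I) = -ww (y * I) - ww ((2 - y : ℝ) * I) := by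
  have key : ∀ (t s : ℝ), t ≠ s → (t:ℂ) * I ≠ s * I := by
    intro t s h h'
    have := mul_right_cancel₀ I_ne_zero h'
    exact h (by exact_mod_cast this)
  have n0 : ∀ t : ℝ, t ≠ 0 → (t:ℂ) * I ≠ 0 := by
    intro t ht; simpa using key t 0 ht
  have n1 : ∀ t : ℝ, t ≠ 1 → (t:ℂ) * I ≠ I := by
    intro t ht; simpa using key t 1 ht
  have n2 : ∀ t : ℝ, t ≠ 2 → (t:ℂ) * I ≠ 2 * I := by
    intro t ht; simpa using key t 2 ht
  have m1 : (2 - y) ≠ 1 := fun h => hy1 (by linarith)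
  rw [HH_ne _ (n0 y hy.ne') (n1 y hy1) (n2 y hy2.ne), HH_ne _ (n0 _ (by linarith)) (n1 _ m1) (n2 _ (by linarith))]
  have he := exp_ne_one (y * I) (by simp; linarith) (by simp; linarith) (n0 y hy.ne') (n1 y hy1) (n2 y hy2.ne)
  have hs := sub_ne_zero.2 (n1 y hy1)
  rw [show (((2 - y : ℝ):ℂ)) * I = 2 * I - y * I by push_cast; ring]
  generalize (y:ℂ) * I = z at *
  rw [GG, GG, ww_refl]
  have e1 : cexp (2 * π * (2 * I - z)) = (cexp (2 * π * z))⁻¹ := by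
    rw [show 2 * π * (2 * I - z) = -(2 * π * z) + 2 * π * I + 2 * π * I by ring, Complex.exp_periodic, 
      Complex.exp_periodic, Complex.exp_neg]
  rw [e1]
  have hx : cexp (2 * π * z) ≠ 0 := Complex.exp_ne_zero _
  generalize cexp (2 * π * z) = q at *
  have hq : q⁻¹ - 1 ≠ 0 := by
    intro h
    apply he
    have : q⁻¹ = 1 := by linear_combination h
    rw [inv_eq_one] at this
    rw [this]; ring
  have hs' : 2 * I - z - I ≠ 0 := by
    intro h; apply hs; linear_combination -h
  have t1 : ww z / (q - 1) + ww z * q / (q⁻¹ - 1) = -ww z - ww z * q := by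
    have : q⁻¹ - 1 = -(q - 1) / q := by field_simp; ring
    rw [this]
    field_simp
    ring
  have t2 : rr / (2 * I - z - I) = - (rr / (z - I)) := by
    rw [show 2 * I - z - I = -(z - I) by ring, div_neg]
  rw [t2]
  linear_combination t1

open Complex in
lemma HH_left : ∫ y in (0:ℝ)..2, HH (y * I) = - ∫ y in (0:ℝ)..2, ww (y * I) := by
  have i1 : IntervalIntegrable (fun y : ℝ => HH (y * I)) volume 0 2 := by
    apply ContinuousOn.intervalIntegrable
    intro y hy
    rw [Set.uIcc_of_le (by norm_num)] at hy
    apply ContinuousAt.continuousWithinAt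
    exact ContinuousAt.comp (g := HH) (f := fun y : ℝ => (y:ℂ) * I)
      (HH_cont _ (by simpa using hy.1) (by simpa using hy.2)) (by fun_prop)
  have i2 : IntervalIntegrable (fun y : ℝ => ww (y * I)) volume 0 2 := by
    apply Continuous.intervalIntegrable
    unfold ww ee; fun_prop
  have r : ∀ f : ℝ → ℂ, ∫ y in (0:ℝ)..2, f (2 - y) = ∫ y in (0:ℝ)..2, f y := by
    intro f
    rw [intervalIntegral.integral_comp_sub_left]; simp
  have i1' : IntervalIntegrable (fun y : ℝ => HH ((2 - y : ℝ) * I)) volume 0 2 := by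
    have := (i1.comp_sub_left 2).symm
    simpa using this
  have i2' : IntervalIntegrable (fun y : ℝ => ww ((2 - y : ℝ) * I)) volume 0 2 := by
    have := (i2.comp_sub_left 2).symm
    simpa using this
  have h : ∫ y in (0:ℝ)..2, (HH (y * I) + HH ((2 - y : ℝ) * I))
      = ∫ y in (0:ℝ)..2, (-ww (y * I) - ww ((2 - y : ℝ) * I)) := by
    apply intervalIntegral.integral_congr_ae
    have a1 : ∀ᵐ y : ℝ, y ≠ 1 := by simp [ae_iff]
    have a2 : ∀ᵐ y : ℝ, y ≠ 2 := by simp [ae_iff]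
    filter_upwards [a1, a2] with y y1 y2 hy
    rw [Set.uIoc_of_le (by norm_num)] at hy
    exact HH_refl y hy.1 (lt_of_le_of_ne hy.2 y2) y1
  rw [intervalIntegral.integral_add i1 i1', intervalIntegral.integral_sub (f := fun y : ℝ => -ww (y * I)) i2.neg i2',
    r (fun y => HH (y * I)), r (fun y => ww (y * I)), intervalIntegral.integral_neg] at h
  linear_combination h / 2

noncomputable def FF (x : ℝ) : ℂ := x * ee x / (Complex.exp (2 * π * x) - 1)

open Complex in
lemma ee_real (x : ℝ) : ‖ee x‖ = 1 := by
  have := ee_norm x 0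
  simpa using this

open Complex in
lemma cexp_real (x : ℝ) : cexp (2 * π * x) - 1 = ((Real.exp (2 * π * x) - 1 : ℝ) : ℂ) := by
  push_cast; rfl

open Complex in
lemma rexp_pos (x : ℝ) (hx : 0 < x) : x * Real.exp x ≤ Real.exp (2 * π * x) - 1 := by
  have h1 : Real.exp (2 * x) ≤ Real.exp (2 * π * x) := by
    apply Real.exp_le_exp.2
    nlinarith [pi_gt_three]
  have h2 : Real.exp (2 * x) = Real.exp x * Real.exp x := by rw [← Real.exp_add]; ring_nf
  have h3 := Real.add_one_le_exp x
  have h4 : 1 ≤ Real.exp x := Real.one_le_exp hx.le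
  nlinarith

open Complex in
lemma FF_int : IntegrableOn FF (Set.Ioi 0) := by
  refine Integrable.mono' (g := fun x => Real.exp (-x)) (integrableOn_exp_neg_Ioi 0) ?_ ?_
  · refine ContinuousOn.aestronglyMeasurable ?_ measurableSet_Ioi
    unfold FF ee
    refine ContinuousOn.div (by fun_prop) (by fun_prop) ?_
    intro x hx
    have hx : 0 < x := hx
    rw [cexp_real]
    have := rexp_pos x hx
    have : 0 < x * Real.exp x := by positivity
    exact_mod_cast (show Real.exp (2 * π * x) - 1 ≠ 0 by linarith)
  · filter_upwards [ae_restrict_mem measurableSet_Ioi] with x hx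
    have hx : 0 < x := hx
    have h1 := rexp_pos x hx
    have h2 : 0 < x * Real.exp x := by positivity
    rw [FF, norm_div, norm_mul, ee_real, cexp_real, norm_real, norm_real, Real.norm_of_nonneg hx.le,
      Real.norm_of_nonneg (by linarith), div_le_iff₀ (by linarith)]
    calc x * 1 = Real.exp (-x) * (x * Real.exp x) := by
          rw [Real.exp_neg]; field_simp
      _ ≤ _ := by gcongr

open Complex in
lemma HH_diff_edge (x : ℝ) (hx : 0 < x) :
    HH x - HH (x + 2 * I) = ww (x + 2 * I) - 4 * I * FF x - ((1 / π * (1 + x ^ 2)⁻¹ : ℝ) : ℂ) := by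
  have h1 := rexp_pos x hx
  have h2 : 0 < x * Real.exp x := by positivity
  have he : cexp (2 * π * x) - 1 ≠ 0 := by
    rw [cexp_real]
    exact_mod_cast (show Real.exp (2 * π * x) - 1 ≠ 0 by linarith)
  have hre : ∀ z : ℂ, z.re = x → ∀ w : ℂ, w.re = 0 → z ≠ w := by
    intro z hz w hw h
    rw [h, hw] at hz; linarith
  rw [HH_ne x (hre _ (by simp) _ (by simp)) (hre _ (by simp) _ (by simp)) (hre _ (by simp) _ (by simp)),
    HH_ne (x + 2 * I) (hre _ (by simp) _ (by simp)) (hre _ (by simp) _ (by simp)) (hre _ (by simp) _ (by simp))]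
  rw [GG, GG, FF, show 2 * π * (x + 2 * I) = (2 * π * x : ℂ) + 2 * π * I + 2 * π * I by ring,
    Complex.exp_periodic, Complex.exp_periodic, ww, ww, ee_shift, Complex.exp_neg]
  have hq : cexp (2 * π * x) ≠ 0 := Complex.exp_ne_zero _
  have hm : (x:ℂ) - I ≠ 0 := sub_ne_zero.2 (hre _ (by simp) _ (by simp))
  have hp : (x:ℂ) + I ≠ 0 := by
    intro h
    have := congrArg Complex.re h
    simp at this; linarith
  have t1 : rr / (x - I) - rr / (x + 2 * I - I) = ((1 / π * (1 + x ^ 2)⁻¹ : ℝ) : ℂ) := by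
    rw [show (x:ℂ) + 2 * I - I = x + I by ring, rr]
    have hpi : (π:ℂ) ≠ 0 := by exact_mod_cast pi_ne_zero
    have hx2 : (1 + (x:ℂ) ^ 2) = (x - I) * (x + I) := by ring_nf; simp; ring
    push_cast
    rw [hx2]
    field_simp
    ring_nf
    simp
  rw [← t1]
  generalize cexp (2 * π * x) = q at *
  field_simp
  ring

open Complex in
lemma FF_eval : -4 * I * (∫ x in Set.Ioi (0:ℝ), FF x) = 1 / 2 - (2 / π - (1 + I) / 2 / (I * π)) := by
  have hlim := rect_lim HH
    (fun z hz => (HH_cont z hz.2.1 hz.2.2).continuousWithinAt)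
    (fun z h1 h2 h3 => ?_) (fun R => 10 / R)
    (tendsto_const_nhds.div_atTop Filter.tendsto_id) HH_bound
  · have i3 : IntegrableOn (fun x : ℝ => ((1 / π * (1 + x ^ 2)⁻¹ : ℝ) : ℂ)) (Set.Ioi 0) :=
      ((integrable_inv_one_add_sq.const_mul (1 / π)).ofReal).integrableOn
    have i2 := FF_int.const_mul (4 * I)
    have hint := (ww_int.sub i2).sub i3
    have h1 := intervalIntegral_tendsto_integral_Ioi 0 hint Filter.tendsto_id
    have h2 := tendsto_nhds_unique hlim (h1.congr' (by
      filter_upwards [Filter.eventually_gt_atTop 0] with R hR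
      apply intervalIntegral.integral_congr_ae
      filter_upwards with x hx
      rw [Set.uIoc_of_le (by exact hR.le)] at hx
      exact (HH_diff_edge x hx.1).symm))
    rw [integral_sub' (ww_int.sub i2) i3, integral_sub' ww_int i2, HH_left, integral_const_mul,
      integral_complex_ofReal, integral_const_mul, integral_Ioi_inv_one_add_sq] at h2
    have h3 : ((1 / π * (π / 2 - Real.arctan 0) : ℝ) : ℂ) = 1 / 2 := by
      rw [Real.arctan_zero]
      have : 1 / π * (π / 2 - 0) = 1 / 2 := by field_simp; norm_num
      rw [this]; norm_num
    rw [← ww_eval]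
    rw [h3] at h2
    linear_combination -h2
  · have hre : ∀ w : ℂ, w.re = 0 → z ≠ w := by
      intro w hw h
      rw [h, hw] at h1; linarith
    exact HH_diff z h2.le h3.le (hre _ (by simp)) (hre _ (by simp)) (hre _ (by simp))

theorem stmt19 :
    ∫ x in Set.Ioi (0:ℝ), Real.sin (π * x / 2) / (Real.exp (2 * π * Real.sqrt x) - 1) = (π - 3) / (4 * π) := by
  rw [← integral_comp_rpow_Ioi_of_pos (p := 2) (by norm_num)]
  have h1 : ∫ x in Set.Ioi (0:ℝ), (2 * x ^ ((2:ℝ) - 1)) •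
      (Real.sin (π * x ^ (2:ℝ) / 2) / (Real.exp (2 * π * Real.sqrt (x ^ (2:ℝ))) - 1))
      = ∫ x in Set.Ioi (0:ℝ), 2 * (FF x).im := by
    apply setIntegral_congr_fun measurableSet_Ioi
    intro x hx
    have hx : 0 < x := hx
    have e1 : (2:ℝ) - 1 = 1 := by norm_num
    have e2 : ee x = Complex.exp (((π * x ^ 2 / 2 : ℝ) : ℂ) * Complex.I) := by
      rw [ee]; congr 1; push_cast; ring
    simp only [e1, Real.rpow_one, Real.rpow_two, Real.sqrt_sq hx.le, smul_eq_mul]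
    rw [FF, cexp_real, Complex.div_ofReal_im, Complex.im_ofReal_mul, e2, Complex.exp_ofReal_mul_I_im]
    ring
  rw [h1, integral_const_mul]
  have h2 : ∫ x in Set.Ioi (0:ℝ), (FF x).im = (∫ x in Set.Ioi (0:ℝ), FF x).im := integral_im FF_int
  rw [h2]
  have h3 := congrArg Complex.re FF_eval
  generalize (∫ x in Set.Ioi (0:ℝ), FF x) = Y at *
  have h4 : (1 + Complex.I) / 2 / (Complex.I * π) = ((1 / (2 * π) : ℝ) : ℂ) - ((1 / (2 * π) : ℝ) : ℂ) * Complex.I := by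
    have hpi : (π:ℂ) ≠ 0 := by exact_mod_cast pi_ne_zero
    have := Complex.I_ne_zero
    push_cast
    field_simp
    ring_nf
    simp; ring
  have h5 : (1 / 2 - (2 / π - (1 + Complex.I) / 2 / (Complex.I * π)) : ℂ) =
      ((1 / 2 - 2 / π + 1 / (2 * π) : ℝ) : ℂ) - ((1 / (2 * π) : ℝ) : ℂ) * Complex.I := by
    rw [h4]; push_cast; ring
  rw [h5] at h3
  simp only [Complex.sub_re, Complex.ofReal_re, Complex.re_ofReal_mul, Complex.I_re, mul_zero, sub_zero] at h3
  simp at h3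
  field_simp
  field_simp at h3
  linarith
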